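/- For every real β with mse_Y ≤ β < mse_∞, there exists a unique v ≥ 0 such that (mse_∞ − β)·G((√θ/σ)·v) = mse_∞ − mse_Y. -/

import Mathlib

open Real MeasureTheory Filter Set

/-- `G x = (e^{x²}/x) ∫_0^x e^{-t²} dt` for `x ≠ 0`, and `G 0 = 1`. -/
noncomputable def G (x : ℝ) : ℝ :=
  if x = 0 then 1 else (Real.exp (x ^ 2) / x) * ∫ t in (0:ℝ)..x, Real.exp (-t ^ 2)

/-- `mse_∞ = σ²/(2θ)`. -/
noncomputable def mseInf (θ σ : ℝ) : ℝ := σ ^ 2 / (2 * θ)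

/-- `mse_Y = (σ²/(2θ)) ∫ (1 - e^{-2θy}) dμ(y)`. -/
noncomputable def mseY (θ σ : ℝ) (μ : Measure ℝ) : ℝ :=
  σ ^ 2 / (2 * θ) * ∫ y, (1 - Real.exp (-(2 * θ * y))) ∂μ

lemma G_eq (x : ℝ) : G x = ∫ s in (0:ℝ)..1, Real.exp (x ^ 2 * (1 - s ^ 2)) := by
  unfold G
  split_ifs with h
  · simp [h]
  · have h1 := intervalIntegral.mul_integral_comp_mul_left (a := 0) (b := 1)
      (f := fun t : ℝ => Real.exp (-t ^ 2)) x
    simp only [mul_zero, mul_one] at h1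
    rw [← h1, ← mul_assoc, div_mul_cancel₀ _ h, ← intervalIntegral.integral_const_mul]
    congr 1
    ext s
    rw [← Real.exp_add]
    congr 1
    ring

lemma G_continuous : Continuous G := by
  have h : G = fun x => ∫ s in (0:ℝ)..1, Real.exp (x ^ 2 * (1 - s ^ 2)) := funext G_eq
  rw [h]
  apply intervalIntegral.continuous_parametric_intervalIntegral_of_continuous'
  unfold Function.uncurry
  fun_prop

lemma G_strictMonoOn : StrictMonoOn G (Ici 0) := by
  intro x hx y hy hxy
  simp only [mem_Ici] at hx hy
  have hsq : x ^ 2 < y ^ 2 := by nlinarith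
  rw [G_eq, G_eq]
  apply intervalIntegral.integral_lt_integral_of_continuousOn_of_le_of_exists_lt
    zero_lt_one (by fun_prop) (by fun_prop)
  · intro s hs
    apply Real.exp_le_exp.2
    have : 0 ≤ 1 - s ^ 2 := by nlinarith [hs.1, hs.2]
    exact mul_le_mul_of_nonneg_right hsq.le this
  · refine ⟨0, by simp, ?_⟩
    simpa using hsq

lemma G_lower (x : ℝ) : 1 + x ^ 2 * (2 / 3) ≤ G x := by
  rw [G_eq]
  have h : ∫ s in (0:ℝ)..1, (1 + x ^ 2 * (1 - s ^ 2)) = 1 + x ^ 2 * (2 / 3) := by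
    rw [intervalIntegral.integral_add (Continuous.intervalIntegrable (by fun_prop) _ _)
      (Continuous.intervalIntegrable (by fun_prop) _ _), intervalIntegral.integral_const_mul,
      intervalIntegral.integral_sub (Continuous.intervalIntegrable (by fun_prop) _ _)
      (Continuous.intervalIntegrable (by fun_prop) _ _)]
    simp
    norm_num
  rw [← h]
  apply intervalIntegral.integral_mono_on zero_le_one
    (Continuous.intervalIntegrable (by fun_prop) _ _)
    (Continuous.intervalIntegrable (by fun_prop) _ _)
  intro s _
  linarith [Real.add_one_le_exp (x ^ 2 * (1 - s ^ 2))]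

/-- For every `β` with `mse_Y ≤ β < mse_∞`, there is a unique `v ≥ 0` with
`(mse_∞ - β) G((√θ/σ) v) = mse_∞ - mse_Y`. -/
theorem threshold_existsUnique (θ σ : ℝ) (hθ : 0 < θ) (hσ : 0 < σ)
    (μ : Measure ℝ) [IsProbabilityMeasure μ] (hsupp : ∀ᵐ y ∂μ, 0 ≤ y)
    (hint : Integrable (fun y : ℝ => y) μ) (hmean : 0 < ∫ y, y ∂μ)
    (β : ℝ) (hβ₁ : mseY θ σ μ ≤ β) (hβ₂ : β < mseInf θ σ) :
    ∃! v : ℝ, 0 ≤ v ∧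
      (mseInf θ σ - β) * G (Real.sqrt θ / σ * v) = mseInf θ σ - mseY θ σ μ := by
  have hd : 0 < mseInf θ σ - β := by linarith
  have hk : 0 < Real.sqrt θ / σ := div_pos (Real.sqrt_pos.2 hθ) hσ
  set k := Real.sqrt θ / σ
  set c := (mseInf θ σ - mseY θ σ μ) / (mseInf θ σ - β) with hc
  have hc1 : 1 ≤ c := by
    rw [hc, le_div_iff₀ hd]; linarith
  have hiff : ∀ g : ℝ, (mseInf θ σ - β) * g = mseInf θ σ - mseY θ σ μ ↔ g = c := by
    intro g
    rw [hc, eq_div_iff hd.ne', mul_comm]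
  simp only [hiff]
  have hmem : c ∈ Icc (G 0) (G c) := by
    refine ⟨by simpa [G] using hc1, ?_⟩
    nlinarith [G_lower c, sq_nonneg (c - 1)]
  obtain ⟨x, hx, hxc⟩ := intermediate_value_Icc (by linarith : (0:ℝ) ≤ c)
    G_continuous.continuousOn hmem
  refine ⟨x / k, ⟨div_nonneg hx.1 hk.le, ?_⟩, ?_⟩
  · rw [mul_div_cancel₀ _ hk.ne']; exact hxc
  · rintro v ⟨hv, hGv⟩
    have := G_strictMonoOn.injOn (mul_nonneg hk.le hv : k * v ∈ Ici (0:ℝ)) hx.1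
      (hGv.trans hxc.symm)
    rw [eq_div_iff hk.ne', mul_comm]; exact this
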